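/- arXiv:2103.03037 — 2 statements merged into one kernel-verified Lean document; each statement's English description precedes it below -/
import Mathlib

section
/- Let K be a field, V a K-vector space, and let H and C be K-subspaces of V with H ∩ C = {0}. Let ι be a finite index type, θ : ι → V a linearly independent family with θ i ∈ C for every i, and γ : ι → ⋀V a family of elements each of which lies in the subalgebra of ⋀V generated by the image of H under the canonical inclusion. If ∑_{i ∈ ι} ι(θ i) * γ i = 0 in ⋀V, then γ i = 0 for every i ∈ ι. -/
/-- Linearly independent vectors spanning a subspace disjoint from `H` admit dual functionals
vanishing on `H`. -/
theorem LinearIndependent.exists_dual_eq_single_of_disjoint {K V ι : Type*} [Field K]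
    [AddCommGroup V] [Module K V] [DecidableEq ι] {θ : ι → V} (hθ : LinearIndependent K θ)
    {H : Submodule K V} (hH : Disjoint (Submodule.span K (Set.range θ)) H) (i : ι) :
    ∃ d : Module.Dual K V, (∀ h ∈ H, d h = 0) ∧ ∀ j, d (θ j) = if j = i then 1 else 0 := by
  have hli : LinearIndependent K (H.mkQ ∘ θ) := hθ.map (by rwa [Submodule.ker_mkQ])
  obtain ⟨g, hg⟩ := LinearMap.exists_extend (Finsupp.lapply i ∘ₗ hli.repr)
  refine ⟨g ∘ₗ H.mkQ, fun h hh => ?_, fun j => ?_⟩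
  · simp [(Submodule.Quotient.mk_eq_zero H).2 hh]
  · have hj := LinearMap.congr_fun hg ⟨(H.mkQ ∘ θ) j, Submodule.subset_span ⟨j, rfl⟩⟩
    rw [LinearMap.comp_apply, LinearMap.comp_apply,
      hli.repr_eq_single j _ rfl] at hj
    simpa [Finsupp.single_apply] using hj

/-- Contraction by a functional vanishing on `H` kills the subalgebra generated by `H`. -/
theorem CliffordAlgebra.contractLeft_eq_zero_of_mem_adjoin {R M : Type*} [CommRing R]
    [AddCommGroup M] [Module R M] {Q : QuadraticForm R M} {d : Module.Dual R M} {H : Set M}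
    (hd : ∀ h ∈ H, d h = 0) {x : CliffordAlgebra Q}
    (hx : x ∈ Algebra.adjoin R (CliffordAlgebra.ι Q '' H)) :
    CliffordAlgebra.contractLeft d x = 0 := by
  suffices ∀ y : CliffordAlgebra Q, CliffordAlgebra.contractLeft d y = 0 →
      CliffordAlgebra.contractLeft d (x * y) = 0 by
    simpa using this 1 (CliffordAlgebra.contractLeft_one (d := d) Q)
  induction hx using Algebra.adjoin_induction with
  | mem x hx =>
    obtain ⟨h, hh, rfl⟩ := hx
    intro y hy
    simp [CliffordAlgebra.contractLeft_ι_mul, hd h hh, hy]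
  | algebraMap r =>
    intro y hy
    simp [CliffordAlgebra.contractLeft_algebraMap_mul, hy]
  | add a b _ _ iha ihb =>
    intro y hy
    simp [add_mul, iha y hy, ihb y hy]
  | mul a b _ _ iha ihb =>
    intro y hy
    rw [mul_assoc]
    exact iha _ (ihb y hy)

/-- If `θ i` are linearly independent vectors lying in a subspace `C` complementary
to `H` (`H ⊓ C = ⊥`), and each `γ i` lies in the subalgebra of the exterior algebra
generated by the image of `H`, then `∑ i, ι (θ i) * γ i = 0` forces all `γ i = 0`. -/
theorem stmt_0 {K V : Type*} [Field K] [AddCommGroup V] [Module K V]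
    (H C : Submodule K V) (hHC : H ⊓ C = ⊥)
    {ι : Type*} [Fintype ι] (θ : ι → V)
    (hθ : LinearIndependent K θ) (hθC : ∀ i, θ i ∈ C)
    (γ : ι → ExteriorAlgebra K V)
    (hγ : ∀ i, γ i ∈ Algebra.adjoin K
      (⇑(ExteriorAlgebra.ι K (M := V)) '' (H : Set V)))
    (hsum : ∑ i, ExteriorAlgebra.ι K (θ i) * γ i = 0) :
    ∀ i, γ i = 0 := by
  classical
  intro i
  have hdisj : Disjoint (Submodule.span K (Set.range θ)) H :=
    (disjoint_iff.2 hHC).symm.mono_left (Submodule.span_le.2 (Set.range_subset_iff.2 hθC))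
  obtain ⟨d, hdH, hdθ⟩ := hθ.exists_dual_eq_single_of_disjoint hdisj i
  have hcontract (j : ι) : CliffordAlgebra.contractLeft d (ExteriorAlgebra.ι K (θ j) * γ j) =
      if j = i then γ j else 0 := by
    have hγj := CliffordAlgebra.contractLeft_eq_zero_of_mem_adjoin hdH (hγ j)
    rw [ExteriorAlgebra.ι, CliffordAlgebra.contractLeft_ι_mul, hγj, hdθ]
    simp
  have h := congrArg (CliffordAlgebra.contractLeft d) hsum
  rw [map_sum, map_zero, Finset.sum_congr rfl fun j _ => hcontract j] at h
  simpa using h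
end

section
/- Fix integers p ≥ 1 and n ≥ p. Let W be a ℂ-vector space, and let (x_μ)_{μ ∈ Fin(2p+1)} and (θ_{k,μ})_{k ∈ Fin(n²), μ ∈ Fin(2p+1)} be families of vectors of W such that the combined family consisting of all the x_μ together with all the θ_{k,μ} is linearly independent over ℂ. Let (𝔢_k)_{k ∈ Fin(n²)} be an ℝ-basis of the real vector space of skew-Hermitian n×n complex matrices. In the exterior algebra ⋀W over ℂ, define the n×n matrix Θ with entries Θ_{a,b} = ∑_{k,μ} (𝔢_k)_{a,b} • (ι(x_μ) * ι(θ_{k,μ})), and let F be an n×n matrix over ⋀W each entry of which lies in the ℂ-linear span of the products ι(x_μ) * ι(x_ν), μ, ν ∈ Fin(2p+1). If trace(Θ * F^p) = 0, where F^p is the p-fold matrix product of F with itself, then F^p = 0. -/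
open CliffordAlgebra in
/-- Contraction of `ι x * b`, in the exterior algebra. -/
theorem ExteriorAlgebra.contractLeft_ι_mul' {W : Type*} [AddCommGroup W] [Module ℂ W]
    (d : Module.Dual ℂ W) (a : W) (b : ExteriorAlgebra ℂ W) :
    contractLeft d (ExteriorAlgebra.ι ℂ a * b) =
      d a • b - ExteriorAlgebra.ι ℂ a * contractLeft d b :=
  contractLeft_ι_mul (Q := (0 : QuadraticForm ℂ W)) d a b

/-- A linearly independent family over a field admits dual functionals. -/
theorem LinearIndependent.exists_dual_single {K V I : Type*} [Field K] [AddCommGroup V]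
    [Module K V] [DecidableEq I] {v : I → V} (hv : LinearIndependent K v) (i : I) :
    ∃ d : Module.Dual K V, ∀ j, d (v j) = if j = i then 1 else 0 := by
  obtain ⟨d, hd⟩ := LinearMap.exists_extend ((Finsupp.lapply i).comp hv.repr :
    Submodule.span K (Set.range v) →ₗ[K] K)
  refine ⟨d, fun j => ?_⟩
  have h := LinearMap.congr_fun hd ⟨v j, Submodule.subset_span ⟨j, rfl⟩⟩
  simp only [LinearMap.comp_apply, Submodule.subtype_apply] at h
  rw [h]
  simp [hv.repr_eq_single j ⟨v j, Submodule.subset_span ⟨j, rfl⟩⟩ rfl, Finsupp.single_apply]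

namespace ExteriorAlgebra

open CliffordAlgebra (contractLeft)

variable {W : Type*} [AddCommGroup W] [Module ℂ W] {I : Type*}

/-- The span of the products `ι (x i) * ι (x j)`. -/
abbrev quadraticSpan (x : I → W) : Submodule ℂ (ExteriorAlgebra ℂ W) :=
  Submodule.span ℂ (Set.range fun ij : I × I => ι ℂ (x ij.1) * ι ℂ (x ij.2))

theorem contractLeft_mul_of_mem_quadraticSpan {x : I → W} {d : Module.Dual ℂ W}
    (hd : ∀ i, d (x i) = 0) {f : ExteriorAlgebra ℂ W} (hf : f ∈ quadraticSpan x)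
    (g : ExteriorAlgebra ℂ W) :
    contractLeft d (f * g) = f * contractLeft d g := by
  induction hf using Submodule.span_induction with
  | mem f hf =>
    obtain ⟨ij, rfl⟩ := hf
    simp [mul_assoc, contractLeft_ι_mul', hd]
  | zero => simp
  | add f₁ f₂ _ _ h₁ h₂ => simp [add_mul, h₁, h₂]
  | smul c f _ h => simp [h]

theorem contractLeft_pow_apply_eq_zero {n : ℕ} {x : I → W} {d : Module.Dual ℂ W}
    (hd : ∀ i, d (x i) = 0) {F : Matrix (Fin n) (Fin n) (ExteriorAlgebra ℂ W)}
    (hF : ∀ a b, F a b ∈ quadraticSpan x) (m : ℕ) (a b : Fin n) :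
    contractLeft d ((F ^ m) a b) = 0 := by
  induction m generalizing a b with
  | zero =>
    by_cases h : a = b
    · simp [h]
    · simp [h]
  | succ m ih =>
    simp [pow_succ', Matrix.mul_apply, contractLeft_mul_of_mem_quadraticSpan hd (hF _ _), ih]

variable [Fintype I]

/-- The number operator `∑ i, x i ∧ (d i ⌋ ·)`. -/
noncomputable def numberOperator (x : I → W) (d : I → Module.Dual ℂ W) :
    ExteriorAlgebra ℂ W →ₗ[ℂ] ExteriorAlgebra ℂ W :=
  ∑ i, LinearMap.mulLeft ℂ (ι ℂ (x i)) ∘ₗ contractLeft (d i)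

theorem numberOperator_apply (x : I → W) (d : I → Module.Dual ℂ W) (g : ExteriorAlgebra ℂ W) :
    numberOperator x d g = ∑ i, ι ℂ (x i) * contractLeft (d i) g := by
  simp [numberOperator]

variable [DecidableEq I] {x : I → W} {d : I → Module.Dual ℂ W}

theorem numberOperator_ι_mul (hd : ∀ i j, d i (x j) = if j = i then 1 else 0) (j : I)
    (g : ExteriorAlgebra ℂ W) :
    numberOperator x d (ι ℂ (x j) * g) = ι ℂ (x j) * g + ι ℂ (x j) * numberOperator x d g := by
  have anti (i : I) (b : ExteriorAlgebra ℂ W) :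
      ι ℂ (x i) * (ι ℂ (x j) * b) = -(ι ℂ (x j) * (ι ℂ (x i) * b)) := by
    rw [← mul_assoc, ← mul_assoc, ← neg_mul, ← eq_neg_of_add_eq_zero_left (ι_add_mul_swap _ _)]
  simp [numberOperator_apply, contractLeft_ι_mul', hd, mul_sub, anti, Finset.sum_add_distrib,
    Finset.mul_sum, ite_smul]

theorem numberOperator_mul_of_mem_quadraticSpan (hd : ∀ i j, d i (x j) = if j = i then 1 else 0)
    {f : ExteriorAlgebra ℂ W} (hf : f ∈ quadraticSpan x) (g : ExteriorAlgebra ℂ W) :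
    numberOperator x d (f * g) = (2 : ℂ) • (f * g) + f * numberOperator x d g := by
  induction hf using Submodule.span_induction with
  | mem f hf =>
    obtain ⟨ij, rfl⟩ := hf
    simp only [mul_assoc, numberOperator_ι_mul hd, mul_add, two_smul]
    abel
  | zero => simp
  | add f₁ f₂ _ _ h₁ h₂ =>
    simp only [add_mul, map_add, h₁, h₂, smul_add]
    abel
  | smul c f _ h => simp [h, smul_comm c (2 : ℂ)]

theorem numberOperator_pow_apply (hd : ∀ i j, d i (x j) = if j = i then 1 else 0) {n : ℕ}
    {F : Matrix (Fin n) (Fin n) (ExteriorAlgebra ℂ W)} (hF : ∀ a b, F a b ∈ quadraticSpan x)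
    (m : ℕ) (a b : Fin n) :
    numberOperator x d ((F ^ m) a b) = (2 * m : ℂ) • (F ^ m) a b := by
  induction m generalizing a b with
  | zero =>
    by_cases h : a = b
    · simp [h, numberOperator_apply]
    · simp [h]
  | succ m ih =>
    simp only [pow_succ', Matrix.mul_apply, map_sum,
      numberOperator_mul_of_mem_quadraticSpan hd (hF _ _), ih, Finset.smul_sum, mul_smul_comm,
      ← add_smul]
    push_cast
    ring_nf

/-- An element of degree `c ≠ #I` in the `x i` which is annihilated by all `x i` vanishes. -/
theorem eq_zero_of_ι_mul_eq_zero (hd : ∀ i j, d i (x j) = if j = i then 1 else 0)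
    {g : ExteriorAlgebra ℂ W} {c : ℂ} (hc : c ≠ Fintype.card I)
    (hN : numberOperator x d g = c • g) (hg : ∀ i, ι ℂ (x i) * g = 0) : g = 0 := by
  have h (i : I) : ι ℂ (x i) * contractLeft (d i) g = g := by
    have := contractLeft_ι_mul' (d i) (x i) g
    rw [hg, map_zero, hd, if_pos rfl, one_smul] at this
    exact (sub_eq_zero.mp this.symm).symm
  rw [numberOperator_apply, Finset.sum_congr rfl fun i _ => h i, Finset.sum_const,
    Finset.card_univ, ← Nat.cast_smul_eq_nsmul ℂ, ← sub_eq_zero, ← sub_smul] at hN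
  exact (smul_eq_zero.mp hN).resolve_left (sub_ne_zero.mpr hc.symm)

end ExteriorAlgebra

/-- If an `ℝ`-linear span contains the skew-Hermitian matrices, the `ℂ`-linear span is everything. -/
theorem Matrix.span_eq_top_of_skewHermitian_mem {n K : Type*} {e : K → Matrix n n ℂ}
    (hspan : ∀ B : Matrix n n ℂ, B.conjTranspose = -B → B ∈ Submodule.span ℝ (Set.range e)) :
    Submodule.span ℂ (Set.range e) = ⊤ := by
  have hC (B : Matrix n n ℂ) (hB : B.conjTranspose = -B) :
      B ∈ Submodule.span ℂ (Set.range e) :=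
    Submodule.span_subset_span ℝ ℂ _ (hspan B hB)
  refine Submodule.eq_top_iff'.mpr fun B => ?_
  have h₁ := hC (B - B.conjTranspose) (by simp)
  have h₂ := hC (Complex.I • (B + B.conjTranspose)) (by
    simp [Matrix.conjTranspose_smul, add_comm])
  have h : B = (1 / 2 : ℂ) • (B - B.conjTranspose) +
      (-Complex.I / 2) • (Complex.I • (B + B.conjTranspose)) := by
    rw [smul_smul, div_mul_eq_mul_div, neg_mul, Complex.I_mul_I, neg_neg, ← smul_add,
      sub_add_add_cancel, ← two_smul ℂ B, smul_smul]
    norm_num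
  rw [h]
  exact add_mem (Submodule.smul_mem _ _ h₁) (Submodule.smul_mem _ _ h₂)


open Matrix in
/-- Algebraic content of Proposition 5.1: with `Θ` the "contact" matrix built from an
`ℝ`-basis `𝔢` of the skew-Hermitian `n × n` matrices and contact covectors `θ k μ`,
and `F` a matrix of "horizontal" 2-forms (spanned by the `ι (x μ) * ι (x ν)`),
the vanishing of `trace (Θ * F ^ p)` forces `F ^ p = 0`. -/
theorem stmt_3 {p n : ℕ} (hp : 1 ≤ p) (hn : p ≤ n)
    {W : Type*} [AddCommGroup W] [Module ℂ W]
    (x : Fin (2 * p + 1) → W) (θ : Fin (n ^ 2) → Fin (2 * p + 1) → W)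
    (hind : LinearIndependent ℂ
      (Sum.elim x (fun kμ : Fin (n ^ 2) × Fin (2 * p + 1) => θ kμ.1 kμ.2)))
    (𝔢 : Fin (n ^ 2) → Matrix (Fin n) (Fin n) ℂ)
    (hskew : ∀ k, (𝔢 k)ᴴ = -(𝔢 k))
    (hindep : LinearIndependent ℝ 𝔢)
    (hspan : ∀ B : Matrix (Fin n) (Fin n) ℂ, Bᴴ = -B →
      B ∈ Submodule.span ℝ (Set.range 𝔢))
    (Θ F : Matrix (Fin n) (Fin n) (ExteriorAlgebra ℂ W))
    (hΘ : ∀ a b, Θ a b = ∑ k, ∑ μ,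
      𝔢 k a b • (ExteriorAlgebra.ι ℂ (x μ) * ExteriorAlgebra.ι ℂ (θ k μ)))
    (hF : ∀ a b, F a b ∈ Submodule.span ℂ
      (Set.range fun μν : Fin (2 * p + 1) × Fin (2 * p + 1) =>
        ExteriorAlgebra.ι ℂ (x μν.1) * ExteriorAlgebra.ι ℂ (x μν.2)))
    (htr : Matrix.trace (Θ * F ^ p) = 0) :
    F ^ p = 0 := by
  open ExteriorAlgebra in
  let L : Matrix (Fin n) (Fin n) ℂ →ₗ[ℂ] ExteriorAlgebra ℂ W :=
    { toFun := fun B => ∑ a, ∑ b, B a b • (F ^ p) b a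
      map_add' := by simp [add_smul, Finset.sum_add_distrib]
      map_smul' := by simp [mul_smul, Finset.smul_sum] }
  have hL (B) : L B = ∑ a, ∑ b, B a b • (F ^ p) b a := rfl
  have htrace : ∑ k, ∑ μ, ι ℂ (x μ) * (ι ℂ (θ k μ) * L (𝔢 k)) = 0 := by
    rw [← htr]
    simp only [Matrix.trace, Matrix.diag, Matrix.mul_apply, hΘ, hL, Finset.sum_mul, Finset.mul_sum,
      mul_smul_comm, smul_mul_assoc, mul_assoc]
    symm
    rw [Finset.sum_comm_cycle]
    exact Finset.sum_congr rfl fun k _ => Finset.sum_comm_cycle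
  choose d hd using hind.exists_dual_single
  have hdx (μ ν) : d (.inl μ) (x ν) = if ν = μ then 1 else 0 := by simpa using hd (.inl μ) (.inl ν)
  have hdθx (kμ ν) : d (.inr kμ) (x ν) = 0 := by simpa using hd (.inr kμ) (.inl ν)
  have hdθ (kμ lν) : d (.inr kμ) (θ lν.1 lν.2) = if lν = kμ then 1 else 0 := by
    simpa using hd (.inr kμ) (.inr lν)
  have hann (k μ) : ι ℂ (x μ) * L (𝔢 k) = 0 := by
    have hdL (l) : CliffordAlgebra.contractLeft (d (.inr (k, μ))) (L (𝔢 l)) = 0 := by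
      simp [hL, contractLeft_pow_apply_eq_zero (hdθx (k, μ)) hF]
    have h := congrArg (CliffordAlgebra.contractLeft (d (.inr (k, μ)))) htrace
    simp only [map_sum, contractLeft_ι_mul', hdθx, hdL, hdθ (k, μ) (_, _)] at h
    rw [← Fintype.sum_prod_type'] at h
    simpa using h
  have hLe (k) : L (𝔢 k) = 0 := by
    refine eq_zero_of_ι_mul_eq_zero (d := fun μ => d (.inl μ)) (c := 2 * p) hdx ?_ ?_ (hann k)
    · simp
    · simp only [hL, map_sum, map_smul, numberOperator_pow_apply (d := fun μ => d (.inl μ)) hdx hF,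
        Finset.smul_sum]
      simp only [smul_comm (2 * p : ℂ)]
  have hL0 : L = 0 := LinearMap.ext_on_range
    (Matrix.span_eq_top_of_skewHermitian_mem hspan) (by simpa using hLe)
  ext a b
  have h := LinearMap.congr_fun hL0 (Matrix.single b a 1)
  simpa [hL, Matrix.single_apply, ite_and, ite_smul] using h
end
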